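/- Let h_1,…,h_n ∈ H and let h = min_{i} h_i be their pointwise minimum. If each h_i is concave and h_j = h for some j ∈ {1,…,n}, then for every X ∈ L^∞: ⊟_{i=1}^n ρ_{h_i}(X) = ⊞_{i=1}^n ρ_{h_i}(X) = ρ_h(X) = □_{i=1}^n ρ_{h_i}(X). -/

import Mathlib

open MeasureTheory ProbabilityTheory Set

noncomputable section

variable {Ω : Type*} [MeasurableSpace Ω]

/-- An atomless measure: every set of positive measure has a measurable subset of
strictly smaller positive measure. -/
def Atomless (P : Measure Ω) : Prop :=
  ∀ A : Set Ω, MeasurableSet A → 0 < P A →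
    ∃ B, B ⊆ A ∧ MeasurableSet B ∧ 0 < P B ∧ P B < P A

/-- Membership in the class `H` of distortion functions: increasing on `[0,1]`,
`h 0 = 0` and `h 1 = 1`. -/
def MemH (h : ℝ → ℝ) : Prop :=
  MonotoneOn h (Icc 0 1) ∧ h 0 = 0 ∧ h 1 = 1

/-- Two random variables are counter-monotonic. -/
def CounterMonotone (P : Measure Ω) (X Y : Ω → ℝ) : Prop :=
  ∀ᵐ p ∂(P.prod P), (X p.1 - X p.2) * (Y p.1 - Y p.2) ≤ 0

/-- Two random variables are comonotonic. -/
def Comonotone (P : Measure Ω) (X Y : Ω → ℝ) : Prop :=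
  ∀ᵐ p ∂(P.prod P), 0 ≤ (X p.1 - X p.2) * (Y p.1 - Y p.2)

/-- A random vector is pairwise counter-monotonic. -/
def PairwiseCtr (P : Measure Ω) {n : ℕ} (Xs : Fin n → Ω → ℝ) : Prop :=
  ∀ i j, i ≠ j → CounterMonotone P (Xs i) (Xs j)

/-- A random vector is (pairwise) comonotonic. -/
def PairwiseCom (P : Measure Ω) {n : ℕ} (Xs : Fin n → Ω → ℝ) : Prop :=
  ∀ i j, i ≠ j → Comonotone P (Xs i) (Xs j)

/-- The distortion risk measure `ρ_h(X) = ∫_0^∞ h(P(X ≥ x)) dx + ∫_{-∞}^0 (h(P(X ≥ x)) − 1) dx`. -/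
def distortion (P : Measure Ω) (h : ℝ → ℝ) (X : Ω → ℝ) : ℝ :=
  (∫ x in Ioi (0:ℝ), h ((P {ω | x ≤ X ω}).toReal)) +
    ∫ x in Iio (0:ℝ), (h ((P {ω | x ≤ X ω}).toReal) - 1)

/-- Bounded (essentially bounded, taking the everywhere-bounded representative)
measurable random variables. -/
def MemLinf (X : Ω → ℝ) : Prop :=
  Measurable X ∧ ∃ M : ℝ, ∀ ω, |X ω| ≤ M

/-- `Xs` is an allocation of `X` in `L^∞`. -/
def IsAlloc (P : Measure Ω) {n : ℕ} (X : Ω → ℝ) (Xs : Fin n → Ω → ℝ) : Prop :=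
  (∀ i, MemLinf (Xs i)) ∧ (∀ᵐ ω ∂P, ∑ i, Xs i ω = X ω)

/-- The (unconstrained) inf-convolution `□_{i=1}^n ρ_{h_i}(X)`, valued in `EReal`. -/
def infConv (P : Measure Ω) {n : ℕ} (h : Fin n → ℝ → ℝ) (X : Ω → ℝ) : EReal :=
  sInf {y : EReal | ∃ Xs : Fin n → Ω → ℝ, IsAlloc P X Xs ∧
    y = ((∑ i, distortion P (h i) (Xs i) : ℝ) : EReal)}

/-- The comonotonic inf-convolution `⊞_{i=1}^n ρ_{h_i}(X)`. -/
def comInfConv (P : Measure Ω) {n : ℕ} (h : Fin n → ℝ → ℝ) (X : Ω → ℝ) : EReal :=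
  sInf {y : EReal | ∃ Xs : Fin n → Ω → ℝ, IsAlloc P X Xs ∧ PairwiseCom P Xs ∧
    y = ((∑ i, distortion P (h i) (Xs i) : ℝ) : EReal)}

/-- The counter-monotonic inf-convolution `⊟_{i=1}^n ρ_{h_i}(X)`. -/
def ctrInfConv (P : Measure Ω) {n : ℕ} (h : Fin n → ℝ → ℝ) (X : Ω → ℝ) : EReal :=
  sInf {y : EReal | ∃ Xs : Fin n → Ω → ℝ, IsAlloc P X Xs ∧ PairwiseCtr P Xs ∧
    y = ((∑ i, distortion P (h i) (Xs i) : ℝ) : EReal)}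

/-- `h` is dually subadditive: `h` is subadditive and its dual `h̃(t) = 1 − h(1−t)`
is superadditive (on `[0,1]`). -/
def DuallySubadditive (h : ℝ → ℝ) : Prop :=
  (∀ x y : ℝ, 0 ≤ x → 0 ≤ y → x + y ≤ 1 → h (x + y) ≤ h x + h y) ∧
  (∀ x y : ℝ, 0 ≤ x → 0 ≤ y → x + y ≤ 1 →
    (1 - h (1 - x)) + (1 - h (1 - y)) ≤ 1 - h (1 - (x + y)))

/-- Four-point inequality for concave functions. -/
lemma ConcaveOn.add_le_add_of_mem_Icc {s : Set ℝ} {f : ℝ → ℝ} (hf : ConcaveOn ℝ s f)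
    {d p q u : ℝ} (hd : d ∈ s) (hu : u ∈ s) (hp : p ∈ Icc d u) (hsum : u + d = p + q) :
    f u + f d ≤ f p + f q := by
  rcases eq_or_lt_of_le (hp.1.trans hp.2) with hdu | hdu
  · subst hdu
    obtain rfl : p = d := le_antisymm hp.2 hp.1
    obtain rfl : q = p := by linarith
    exact le_rfl
  · have hpos : 0 < u - d := sub_pos.2 hdu
    have ha : 0 ≤ (u - p) / (u - d) := div_nonneg (sub_nonneg.2 hp.2) hpos.le
    have hb : 0 ≤ (p - d) / (u - d) := div_nonneg (sub_nonneg.2 hp.1) hpos.le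
    have hab : (u - p) / (u - d) + (p - d) / (u - d) = 1 := by field_simp; ring
    have h1 := hf.2 hd hu ha hb hab
    have h2 := hf.2 hd hu hb ha (by rw [add_comm]; exact hab)
    have e1 : (u - p) / (u - d) * d + (p - d) / (u - d) * u = p := by field_simp; ring
    have e2 : (p - d) / (u - d) * d + (u - p) / (u - d) * u = q := by
      obtain rfl : q = u + d - p := by linarith
      field_simp; ring
    simp only [smul_eq_mul, e1, e2] at h1 h2
    have e3 : f u + f d =
        ((u - p) / (u - d) + (p - d) / (u - d)) * (f u + f d) := by rw [hab, one_mul]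
    linarith

lemma distortion_congr {P : Measure Ω} {h : ℝ → ℝ} {X Y : Ω → ℝ} (hXY : X =ᵐ[P] Y) :
    distortion P h X = distortion P h Y := by
  have : ∀ x : ℝ, P {ω | x ≤ X ω} = P {ω | x ≤ Y ω} := fun x =>
    measure_congr (hXY.mono fun ω hω => by
      change (x ≤ X ω) = (x ≤ Y ω)
      rw [hω])
  simp only [distortion, this]

section Distortion

variable {P : Measure Ω} [IsProbabilityMeasure P] {h : ℝ → ℝ}

lemma measure_toReal_mem_Icc (A : Set Ω) : (P A).toReal ∈ Icc (0 : ℝ) 1 :=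
  ⟨ENNReal.toReal_nonneg, measureReal_le_one (μ := P) (s := A)⟩

lemma MemH.mono_measure (hh : MemH h) {A B : Set Ω} (hAB : A ≤ᵐ[P] B) :
    h (P A).toReal ≤ h (P B).toReal :=
  hh.1 (measure_toReal_mem_Icc A) (measure_toReal_mem_Icc B)
    (ENNReal.toReal_mono (measure_ne_top P B) (measure_mono_ae hAB))

lemma MemH.measure_nonneg (hh : MemH h) (A : Set Ω) : 0 ≤ h (P A).toReal := by
  rw [← hh.2.1]
  exact hh.1 (by simp) (measure_toReal_mem_Icc A) (measure_toReal_mem_Icc A).1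

lemma MemH.measure_le_one (hh : MemH h) (A : Set Ω) : h (P A).toReal ≤ 1 := by
  rw [← hh.2.2]
  exact hh.1 (measure_toReal_mem_Icc A) (by simp) (measure_toReal_mem_Icc A).2

/-- A concave distortion of a probability is a submodular set function. -/
lemma ConcaveOn.measure_union_add_inter_le (hc : ConcaveOn ℝ (Icc 0 1) h) {A B : Set Ω}
    (hB : MeasurableSet B) :
    h (P (A ∪ B)).toReal + h (P (A ∩ B)).toReal ≤ h (P A).toReal + h (P B).toReal :=
  hc.add_le_add_of_mem_Icc (measure_toReal_mem_Icc _) (measure_toReal_mem_Icc _)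
    ⟨measureReal_mono inter_subset_left, measureReal_mono subset_union_left⟩
    (measureReal_union_add_inter hB)

lemma MemH.antitone_survival (hh : MemH h) (X : Ω → ℝ) (B : Set Ω) :
    Antitone fun x => h (P ({ω | x ≤ X ω} ∩ B)).toReal := fun _ _ hxy =>
  hh.mono_measure (Filter.Eventually.of_forall fun _ hω => ⟨hxy.trans hω.1, hω.2⟩)

lemma MemH.antitone_survival_univ (hh : MemH h) (X : Ω → ℝ) :
    Antitone fun x => h (P {ω | x ≤ X ω}).toReal := by
  simpa only [inter_univ] using hh.antitone_survival (P := P) X univ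

/-- For bounded random variables the distortion risk measure is an integral over a bounded
interval. -/
lemma distortion_eq_intervalIntegral (hh : MemH h) {X : Ω → ℝ} {a b : ℝ} (ha : a ≤ 0)
    (hb : 0 ≤ b) (haX : ∀ ω, a ≤ X ω) (hXb : ∀ ω, X ω ≤ b) :
    distortion P h X = a + ∫ x in a..b, h (P {ω | x ≤ X ω}).toReal := by
  have hint : ∀ c d : ℝ, IntervalIntegrable
      (fun x => h (P {ω | x ≤ X ω}).toReal) volume c d := fun c d =>
    (hh.antitone_survival_univ X).intervalIntegrable
  have hpos : ∫ x in Ioi (0 : ℝ), h (P {ω | x ≤ X ω}).toReal =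
      ∫ x in (0 : ℝ)..b, h (P {ω | x ≤ X ω}).toReal := by
    rw [intervalIntegral.integral_of_le hb]
    refine setIntegral_eq_of_subset_of_forall_sdiff_eq_zero measurableSet_Ioi
      Ioc_subset_Ioi_self fun x hx => ?_
    have hbx : b < x := by
      by_contra! hxb
      exact hx.2 ⟨hx.1, hxb⟩
    have : {ω | x ≤ X ω} = ∅ := by
      ext ω
      simpa using (hXb ω).trans_lt hbx
    simp [this, hh.2.1]
  have hneg : ∫ x in Iio (0 : ℝ), (h (P {ω | x ≤ X ω}).toReal - 1) =
      ∫ x in a..0, (h (P {ω | x ≤ X ω}).toReal - 1) := by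
    rw [intervalIntegral.integral_of_le ha, integral_Ioc_eq_integral_Ioo]
    refine setIntegral_eq_of_subset_of_forall_sdiff_eq_zero measurableSet_Iio
      (fun x hx => hx.2) fun x hx => ?_
    have hxa : x ≤ a := by
      by_contra! hax
      exact hx.2 ⟨hax, hx.1⟩
    have : {ω | x ≤ X ω} = univ := by
      ext ω
      simpa using hxa.trans (haX ω)
    simp [this, hh.2.2]
  rw [distortion, hpos, hneg, intervalIntegral.integral_sub (hint _ _) (by simp),
    ← intervalIntegral.integral_add_adjacent_intervals (hint a 0) (hint 0 b)]
  simp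
  ring

lemma MemLinf.exists_bound {X : Ω → ℝ} (hX : MemLinf X) :
    ∃ M : ℝ, 0 ≤ M ∧ ∀ ω, -M ≤ X ω ∧ X ω ≤ M := by
  obtain ⟨M, hM⟩ := hX.2
  exact ⟨|M|, abs_nonneg M, fun ω => abs_le.1 ((hM ω).trans (le_abs_self M))⟩

lemma MemLinf.add {X Y : Ω → ℝ} (hX : MemLinf X) (hY : MemLinf Y) :
    MemLinf fun ω => X ω + Y ω := by
  obtain ⟨M, hM⟩ := hX.2
  obtain ⟨N, hN⟩ := hY.2
  exact ⟨hX.1.add hY.1, M + N, fun ω => (abs_add_le _ _).trans (add_le_add (hM ω) (hN ω))⟩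

lemma memLinf_const (c : ℝ) : MemLinf fun _ : Ω => c :=
  ⟨measurable_const, |c|, fun _ => le_rfl⟩

lemma memLinf_indicator {B : Set Ω} (hB : MeasurableSet B) (c : ℝ) :
    MemLinf (B.indicator fun _ => c) := by
  refine ⟨measurable_const.indicator hB, |c|, fun ω => ?_⟩
  by_cases hω : ω ∈ B <;> simp [hω]

lemma MemLinf.sum {ι : Type*} {Y : ι → Ω → ℝ} (hY : ∀ i, MemLinf (Y i)) (s : Finset ι) :
    MemLinf fun ω => ∑ i ∈ s, Y i ω := by
  classical
  induction s using Finset.induction_on with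
  | empty => simpa using memLinf_const (Ω := Ω) 0
  | insert i s hi ih => simpa only [Finset.sum_insert hi] using (hY i).add ih

lemma distortion_mono (hh : MemH h) {X Y : Ω → ℝ} (hX : MemLinf X) (hY : MemLinf Y)
    (hXY : ∀ ω, X ω ≤ Y ω) : distortion P h X ≤ distortion P h Y := by
  obtain ⟨M, hM, hXM⟩ := hX.exists_bound
  obtain ⟨N, hN, hYN⟩ := hY.exists_bound
  have hbX : ∀ ω, -(M + N) ≤ X ω ∧ X ω ≤ M + N := fun ω => by
    constructor <;> linarith [hXM ω]
  have hbY : ∀ ω, -(M + N) ≤ Y ω ∧ Y ω ≤ M + N := fun ω => by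
    constructor <;> linarith [hYN ω]
  rw [distortion_eq_intervalIntegral hh (by linarith) (by linarith)
      (fun ω => (hbX ω).1) (fun ω => (hbX ω).2),
    distortion_eq_intervalIntegral hh (by linarith) (by linarith)
      (fun ω => (hbY ω).1) (fun ω => (hbY ω).2)]
  gcongr
  refine intervalIntegral.integral_mono_on (by linarith)
    (hh.antitone_survival_univ X).intervalIntegrable
    (hh.antitone_survival_univ Y).intervalIntegrable fun x _ => ?_
  exact hh.mono_measure (Filter.Eventually.of_forall fun ω hω => le_trans hω (hXY ω))

lemma distortion_mono_left {g : ℝ → ℝ} (hg : MemH g) (hh : MemH h) (hgh : ∀ x, g x ≤ h x)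
    {X : Ω → ℝ} (hX : MemLinf X) : distortion P g X ≤ distortion P h X := by
  obtain ⟨M, hM, hXM⟩ := hX.exists_bound
  rw [distortion_eq_intervalIntegral hg (by linarith) hM
      (fun ω => (hXM ω).1) (fun ω => (hXM ω).2),
    distortion_eq_intervalIntegral hh (by linarith) hM
      (fun ω => (hXM ω).1) (fun ω => (hXM ω).2)]
  gcongr
  exact intervalIntegral.integral_mono_on (by linarith)
    (hg.antitone_survival_univ X).intervalIntegrable
    (hh.antitone_survival_univ X).intervalIntegrable fun x _ => hgh _

lemma distortion_zero (hh : MemH h) : distortion P h (fun _ => 0) = 0 := by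
  simpa using distortion_eq_intervalIntegral (P := P) (X := fun _ => 0) hh le_rfl le_rfl
    (fun _ => le_rfl) (fun _ => le_rfl)

lemma distortion_add_const (hh : MemH h) {X : Ω → ℝ} (hX : MemLinf X) (c : ℝ) :
    distortion P h (fun ω => X ω + c) = distortion P h X + c := by
  obtain ⟨M, hM, hXM⟩ := hX.exists_bound
  have hc := neg_abs_le c
  have hc' := le_abs_self c
  rw [distortion_eq_intervalIntegral hh (a := -(M + |c|)) (b := M + |c|)
      (by linarith [abs_nonneg c]) (by linarith [abs_nonneg c])
      (fun ω => by linarith [hXM ω]) (fun ω => by linarith [hXM ω]),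
    distortion_eq_intervalIntegral hh (a := -(M + |c|) - c) (b := M + |c| - c)
      (by linarith) (by linarith)
      (fun ω => by linarith [hXM ω]) (fun ω => by linarith [hXM ω]),
    ← intervalIntegral.integral_comp_sub_right]
  simp only [sub_le_iff_le_add]
  ring

/-- Adding a scaled indicator costs at most the scaled capacity of the set. -/
lemma distortion_add_indicator_le (hh : MemH h) (hc : ConcaveOn ℝ (Icc 0 1) h) {X : Ω → ℝ}
    (hX : MemLinf X) {B : Set Ω} (hB : MeasurableSet B) {c : ℝ} (hc0 : 0 ≤ c) :
    distortion P h (fun ω => X ω + B.indicator (fun _ => c) ω) ≤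
      distortion P h X + c * h (P B).toReal := by
  obtain ⟨M, hM, hXM⟩ := hX.exists_bound
  set R := M + c with hR
  set g : ℝ → ℝ := fun x => h (P ({ω | x ≤ X ω} ∩ B)).toReal with hg_def
  have hg : Antitone g := hh.antitone_survival X B
  have hgi : ∀ a b, IntervalIntegrable g volume a b := fun _ _ => hg.intervalIntegrable
  have hgs : Antitone fun x => g (x - c) := fun x y hxy => hg (by linarith)
  have hind : ∀ ω, 0 ≤ B.indicator (fun _ => c) ω ∧ B.indicator (fun _ => c) ω ≤ c := by
    intro ω
    by_cases hω : ω ∈ B <;> simp [hω, hc0]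
  have hφ := hh.antitone_survival_univ (P := P) X
  rw [distortion_eq_intervalIntegral hh (a := -R) (b := R) (by linarith) (by linarith)
      (fun ω => by linarith [hXM ω, hind ω]) (fun ω => by linarith [hXM ω, hind ω]),
    distortion_eq_intervalIntegral hh (a := -R) (b := R) (by linarith) (by linarith)
      (fun ω => by linarith [hXM ω]) (fun ω => by linarith [hXM ω]), add_assoc]
  gcongr
  have hpt : ∀ x, h (P {ω | x ≤ X ω + B.indicator (fun _ => c) ω}).toReal ≤
      h (P {ω | x ≤ X ω}).toReal + (g (x - c) - g x) := by
    intro x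
    have hsub := hc.measure_union_add_inter_le (P := P) (A := {ω | x ≤ X ω})
      (B := {ω | x - c ≤ X ω} ∩ B) ((measurableSet_le measurable_const hX.1).inter hB)
    have hunion : {ω | x ≤ X ω + B.indicator (fun _ => c) ω} =
        {ω | x ≤ X ω} ∪ ({ω | x - c ≤ X ω} ∩ B) := by
      ext ω
      by_cases hω : ω ∈ B
      · simp only [mem_ofPred_eq, indicator_of_mem hω, mem_union, mem_inter_iff, hω, and_true]
        constructor
        · intro hx
          right
          linarith
        · rintro (hx | hx) <;> linarith
      · simp [hω]
    have hinter : {ω | x ≤ X ω} ∩ ({ω | x - c ≤ X ω} ∩ B) = {ω | x ≤ X ω} ∩ B := by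
      ext ω
      simp only [mem_inter_iff, mem_ofPred_eq]
      constructor
      · exact fun hω => ⟨hω.1, hω.2.2⟩
      · exact fun hω => ⟨hω.1, by linarith [hω.1], hω.2⟩
    rw [hinter] at hsub
    rw [hunion]
    simp only [hg_def]
    linarith
  calc ∫ x in -R..R, h (P {ω | x ≤ X ω + B.indicator (fun _ => c) ω}).toReal
      ≤ ∫ x in -R..R, (h (P {ω | x ≤ X ω}).toReal + (g (x - c) - g x)) :=
        intervalIntegral.integral_mono_on (by linarith)
          (hh.antitone_survival_univ _).intervalIntegrable
          (hφ.intervalIntegrable.add (hgs.intervalIntegrable.sub (hgi _ _)))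
          fun x _ => hpt x
    _ = (∫ x in -R..R, h (P {ω | x ≤ X ω}).toReal) +
          ((∫ x in (-R - c)..(R - c), g x) - ∫ x in -R..R, g x) := by
        rw [intervalIntegral.integral_add hφ.intervalIntegrable
            (hgs.intervalIntegrable.sub (hgi _ _)),
          intervalIntegral.integral_sub hgs.intervalIntegrable (hgi _ _),
          intervalIntegral.integral_comp_sub_right]
    _ ≤ _ := by
        gcongr
        have hleft : ∫ x in (-R - c)..(-R), g x ≤ c * h (P B).toReal := by
          calc ∫ x in (-R - c)..(-R), g x ≤ ∫ x in (-R - c)..(-R), h (P B).toReal :=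
                intervalIntegral.integral_mono_on (by linarith) (hgi _ _) (by simp)
                  fun x _ => hh.mono_measure (Filter.Eventually.of_forall fun _ hω => hω.2)
            _ = c * h (P B).toReal := by simp
        have hright : 0 ≤ ∫ x in (R - c)..R, g x :=
          intervalIntegral.integral_nonneg (by linarith) fun x _ => hh.measure_nonneg _
        have e1 := intervalIntegral.integral_add_adjacent_intervals
          (hgi (-R - c) (-R)) (hgi (-R) (R - c))
        have e2 := intervalIntegral.integral_add_adjacent_intervals
          (hgi (-R) (R - c)) (hgi (R - c) R)
        linarith

lemma distortion_add_sum_indicator_le (hh : MemH h) (hc : ConcaveOn ℝ (Icc 0 1) h) {X : Ω → ℝ}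
    (hX : MemLinf X) {B : ℕ → Set Ω} (hB : ∀ k, MeasurableSet (B k)) {c : ℝ} (hc0 : 0 ≤ c)
    (K : ℕ) :
    distortion P h (fun ω => X ω + ∑ k ∈ Finset.range K, (B k).indicator (fun _ => c) ω) ≤
      distortion P h X + ∑ k ∈ Finset.range K, c * h (P (B k)).toReal := by
  induction K with
  | zero => simp
  | succ K ih =>
    have hstep := distortion_add_indicator_le (P := P) hh hc
      (hX.add (MemLinf.sum (fun k => memLinf_indicator (hB k) c) (Finset.range K))) (hB K) hc0
    simp only [Finset.sum_range_succ, ← add_assoc]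
    linarith

/-- A staircase with steps of width and height `c` lies above the identity up to its last step. -/
lemma min_le_sum_staircase (c y : ℝ) (K : ℕ) :
    min y (K * c) ≤ ∑ k ∈ Finset.range K, if k * c ≤ y then c else 0 := by
  induction K with
  | zero => simp
  | succ K ih =>
    rw [Finset.sum_range_succ]
    push_cast
    split_ifs with hy
    · rw [min_eq_right hy] at ih
      linarith [min_le_right y ((K + 1 : ℝ) * c)]
    · rw [min_eq_left (not_le.1 hy).le] at ih
      linarith [min_le_left y ((K + 1 : ℝ) * c)]

/-- Concave distortion risk measures are subadditive. -/
lemma distortion_add_le (hh : MemH h) (hc : ConcaveOn ℝ (Icc 0 1) h) {X Y : Ω → ℝ}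
    (hX : MemLinf X) (hY : MemLinf Y) :
    distortion P h (fun ω => X ω + Y ω) ≤ distortion P h X + distortion P h Y := by
  refine le_of_forall_pos_le_add fun ε hε => ?_
  obtain ⟨M, hM, hYM⟩ := hY.exists_bound
  obtain ⟨K, hK⟩ := exists_nat_ge (2 * M / ε)
  rw [div_le_iff₀ hε] at hK
  set B : ℕ → Set Ω := fun k => {ω | -M + ε * k ≤ Y ω} with hB_def
  have hB : ∀ k, MeasurableSet (B k) := fun k => measurableSet_le measurable_const hY.1
  have hXM := hX.add (memLinf_const (Ω := Ω) (-M))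
  have hφ := hh.antitone_survival_univ (P := P) Y
  have hdom : ∀ ω, X ω + Y ω ≤
      X ω + -M + ∑ k ∈ Finset.range K, (B k).indicator (fun _ => ε) ω := by
    intro ω
    have hst := min_le_sum_staircase ε (Y ω + M) K
    rw [min_eq_left (by linarith [hYM ω])] at hst
    have : ∑ k ∈ Finset.range K, (B k).indicator (fun _ => ε) ω =
        ∑ k ∈ Finset.range K, if (k : ℝ) * ε ≤ Y ω + M then ε else 0 := by
      refine Finset.sum_congr rfl fun k _ => ?_
      have : ω ∈ B k ↔ (k : ℝ) * ε ≤ Y ω + M := by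
        simp only [hB_def, mem_ofPred_eq]
        constructor <;> intro hω <;> linarith
      simp only [indicator, this]
    linarith
  have hsum : ∑ k ∈ Finset.range K, ε * h (P (B k)).toReal ≤
      ε + ∫ x in -M..(-M + ε * K), h (P {ω | x ≤ Y ω}).toReal := by
    set f : ℝ → ℝ := fun x => h (P {ω | -M + ε * x ≤ Y ω}).toReal with hf_def
    have hf : Antitone f := fun x y hxy => hφ (by gcongr)
    have h1 := (hf.antitoneOn (Icc 0 (0 + (K : ℝ)))).sum_le_integral
    have h2 : ∑ k ∈ Finset.range K, f k ≤ ∑ k ∈ Finset.range K, f (0 + ((k + 1 : ℕ) : ℝ)) + 1 := by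
      have e1 := Finset.sum_range_succ (fun k : ℕ => f k) K
      have e2 := Finset.sum_range_succ' (fun k : ℕ => f k) K
      have e3 : 0 ≤ f K := hh.measure_nonneg _
      have e4 : f ((0 : ℕ) : ℝ) ≤ 1 := hh.measure_le_one _
      simp only [zero_add]
      linarith
    have h3 := intervalIntegral.smul_integral_comp_add_mul (a := 0) (b := K)
      (fun x => h (P {ω | x ≤ Y ω}).toReal) ε (-M)
    rw [mul_zero, add_zero] at h3
    rw [← h3, ← Finset.mul_sum, smul_eq_mul]
    rw [zero_add] at h1
    have := mul_le_mul_of_nonneg_left (h2.trans (add_le_add_left h1 1)) hε.le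
    linarith
  calc distortion P h (fun ω => X ω + Y ω)
      ≤ distortion P h fun ω =>
          X ω + -M + ∑ k ∈ Finset.range K, (B k).indicator (fun _ => ε) ω :=
        distortion_mono hh (hX.add hY)
          (hXM.add (MemLinf.sum (fun k => memLinf_indicator (hB k) ε) _)) hdom
    _ ≤ distortion P h (fun ω => X ω + -M) + ∑ k ∈ Finset.range K, ε * h (P (B k)).toReal :=
        distortion_add_sum_indicator_le hh hc hXM hB hε.le K
    _ ≤ distortion P h X + distortion P h Y + ε := by
        rw [distortion_add_const hh hX, distortion_eq_intervalIntegral (X := Y) hh (a := -M)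
          (b := -M + ε * K) (by linarith) (by linarith) (fun ω => (hYM ω).1)
          (fun ω => by linarith [hYM ω])]
        linarith

lemma distortion_sum_le (hh : MemH h) (hc : ConcaveOn ℝ (Icc 0 1) h) {ι : Type*}
    {Y : ι → Ω → ℝ} (hY : ∀ i, MemLinf (Y i)) (s : Finset ι) :
    distortion P h (fun ω => ∑ i ∈ s, Y i ω) ≤ ∑ i ∈ s, distortion P h (Y i) := by
  classical
  induction s using Finset.induction_on with
  | empty => simp [distortion_zero hh]
  | insert i s hi ih =>
    simp only [Finset.sum_insert hi]
    linarith [distortion_add_le (P := P) hh hc (hY i) (MemLinf.sum hY s)]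

end Distortion

/-- Corollary 1. If each `h_i` is concave and `h_j = min_i h_i` for some `j`,
then `⊟ ρ_{h_i}(X) = ⊞ ρ_{h_i}(X) = ρ_h(X) = □ ρ_{h_i}(X)` for every `X ∈ L^∞`. -/
theorem corollary1
    (P : Measure Ω) [IsProbabilityMeasure P] (hP : Atomless P)
    {n : ℕ} (hn : 0 < n)
    (h : Fin n → ℝ → ℝ) (hH : ∀ i, MemH (h i))
    (hconc : ∀ i, ConcaveOn ℝ (Icc 0 1) (h i))
    (hmin : ℝ → ℝ) (hmin_def : ∀ x, hmin x = ⨅ i, h i x)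
    (hj : ∃ j, h j = hmin)
    (X : Ω → ℝ) (hX : MemLinf X) :
    ctrInfConv P h X = ((distortion P hmin X : ℝ) : EReal) ∧
    comInfConv P h X = ((distortion P hmin X : ℝ) : EReal) ∧
    infConv P h X = ((distortion P hmin X : ℝ) : EReal) := by
  obtain ⟨j, rfl⟩ := hj
  have hle : ∀ i x, h j x ≤ h i x := fun i x => by
    rw [hmin_def]
    exact ciInf_le (finite_range fun i => h i x).bddBelow i
  have hlower : ∀ Xs : Fin n → Ω → ℝ, IsAlloc P X Xs →
      distortion P (h j) X ≤ ∑ i, distortion P (h i) (Xs i) := by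
    intro Xs hXs
    rw [← distortion_congr hXs.2]
    exact (distortion_sum_le (hH j) (hconc j) hXs.1 _).trans
      (Finset.sum_le_sum fun i _ => distortion_mono_left (hH j) (hH i) (hle i) (hXs.1 i))
  let Xs : Fin n → Ω → ℝ := Pi.single j X
  have hXs_ne : ∀ i, i ≠ j → Xs i = fun _ => 0 := fun i hi => Pi.single_eq_of_ne hi _
  have hXs_eq : Xs j = X := Pi.single_eq_same j _
  have halloc : IsAlloc P X Xs := by
    refine ⟨fun i => ?_, Filter.Eventually.of_forall fun ω => ?_⟩
    · by_cases hi : i = j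
      · rw [hi, hXs_eq]
        exact hX
      · rw [hXs_ne i hi]
        exact memLinf_const 0
    · rw [Finset.sum_eq_single j (fun i _ hi => by rw [hXs_ne i hi]) (by simp), hXs_eq]
  have hprod : ∀ i k, i ≠ k → ∀ p : Ω × Ω,
      (Xs i p.1 - Xs i p.2) * (Xs k p.1 - Xs k p.2) = 0 := by
    intro i k hik p
    by_cases hi : i = j
    · rw [hXs_ne k fun hk => hik (hi.trans hk.symm)]
      simp
    · rw [hXs_ne i hi]
      simp
  have hval : ∑ i, distortion P (h i) (Xs i) = distortion P (h j) X := by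
    rw [Finset.sum_eq_single j
      (fun i _ hi => by rw [hXs_ne i hi, distortion_zero (hH i)]) (by simp), hXs_eq]
  refine ⟨le_antisymm (sInf_le ⟨Xs, halloc, fun i k hik => ?_, by rw [hval]⟩) (le_sInf ?_),
    le_antisymm (sInf_le ⟨Xs, halloc, fun i k hik => ?_, by rw [hval]⟩) (le_sInf ?_),
    le_antisymm (sInf_le ⟨Xs, halloc, by rw [hval]⟩) (le_sInf ?_)⟩
  · exact Filter.Eventually.of_forall fun p => (hprod i k hik p).le
  · rintro _ ⟨Ys, hYs, -, rfl⟩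
    exact EReal.coe_le_coe_iff.2 (hlower Ys hYs)
  · exact Filter.Eventually.of_forall fun p => (hprod i k hik p).ge
  · rintro _ ⟨Ys, hYs, -, rfl⟩
    exact EReal.coe_le_coe_iff.2 (hlower Ys hYs)
  · rintro _ ⟨Ys, hYs, rfl⟩
    exact EReal.coe_le_coe_iff.2 (hlower Ys hYs)
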